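/- Mixed ℓ₂/ℓ₁ error bound for the block Basis Pursuit (BBP) with block compressible signals: let q > 1 be real, k ≥ 1, and let x be any block signal. Let S be a set of k block indices containing k largest blocks of x (i.e. ‖x_i‖₂ ≥ ‖x_j‖₂ whenever i ∈ S and j ∉ S), and set φ = ∑_{i∉S} ‖x_i‖₂ (the best block k-term approximation error φ_k(x)). Let ζ ≥ 0, ε with ‖ε‖₂ ≤ ζ, y = A x + ε, and let x̂ satisfy ‖y − A x̂‖₂ ≤ ζ and ‖x̂‖_{2,1} ≤ ‖z‖_{2,1} for every z with ‖y − A z‖₂ ≤ ζ. Suppose β > 0 is such that ‖A z‖₂ ≥ β·‖z‖_{2,q} for every z with ‖z‖_{2,1} ≤ 4·k^{1-1/q}·‖z‖_{2,q}. Then ‖x̂ − x‖_{2,1} ≤ 4·k^{1-1/q}·ζ/β + 4φ. -/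

import Mathlib

open scoped BigOperators

noncomputable section

/-- Mixed ℓ₂/ℓ₁ norm of a block signal: sum of the Euclidean norms of the blocks. -/
def mnorm1 {p n : ℕ} (x : Fin p → EuclideanSpace ℝ (Fin n)) : ℝ := ∑ i, ‖x i‖

/-- Mixed ℓ₂/ℓ_q norm of a block signal. -/
def mnorm {p n : ℕ} (q : ℝ) (x : Fin p → EuclideanSpace ℝ (Fin n)) : ℝ :=
  (∑ i, ‖x i‖ ^ q) ^ (1 / q)

/-- The mixed norm `mnorm q` is nonnegative. -/
lemma mnorm_nonneg {p n : ℕ} (q : ℝ) (h : Fin p → EuclideanSpace ℝ (Fin n)) :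
    0 ≤ mnorm q h :=
  Real.rpow_nonneg (Finset.sum_nonneg fun i _ => Real.rpow_nonneg (norm_nonneg (h i)) q) _

/-- Hölder's inequality for the blocks of `h` indexed by `S`. -/
lemma sum_norm_le_card_rpow_mul_mnorm {p n : ℕ} {q : ℝ} (hq : 1 ≤ q)
    (h : Fin p → EuclideanSpace ℝ (Fin n)) (S : Finset (Fin p)) :
    ∑ i ∈ S, ‖h i‖ ≤ (S.card : ℝ) ^ (1 - 1 / q) * mnorm q h := by
  have hq0 : 0 < q := by linarith
  have hpow : (∑ i ∈ S, ‖h i‖) ^ q ≤ (S.card : ℝ) ^ (q - 1) * ∑ i, ‖h i‖ ^ q := by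
    have hS := Real.rpow_sum_le_const_mul_sum_rpow S (fun i => ‖h i‖) hq
    simp only [abs_norm] at hS
    refine hS.trans ?_
    gcongr
    exact Finset.subset_univ S
  refine (Real.rpow_le_rpow_iff (by positivity)
    (mul_nonneg (by positivity) (mnorm_nonneg q h)) hq0).mp (hpow.trans_eq ?_)
  rw [Real.mul_rpow (by positivity) (mnorm_nonneg q h), mnorm,
    ← Real.rpow_mul (by positivity), ← Real.rpow_mul (by positivity),
    one_div_mul_cancel hq0.ne', Real.rpow_one, sub_mul, one_div_mul_cancel hq0.ne', one_mul]

/-- If `xh` has mixed norm at most that of `x`, then the error `xh - x` is concentrated on any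
block set `S` up to the mass of `x` outside `S`. -/
lemma mnorm1_sub_le {p n : ℕ} {x xh : Fin p → EuclideanSpace ℝ (Fin n)}
    (hle : mnorm1 xh ≤ mnorm1 x) (S : Finset (Fin p)) :
    mnorm1 (xh - x) ≤ 2 * ∑ i ∈ S, ‖(xh - x) i‖ + 2 * ∑ i ∈ Sᶜ, ‖x i‖ := by
  have hS : ∑ i ∈ S, ‖x i‖ ≤ ∑ i ∈ S, ‖xh i‖ + ∑ i ∈ S, ‖(xh - x) i‖ := by
    rw [← Finset.sum_add_distrib]
    refine Finset.sum_le_sum fun i _ => ?_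
    rw [Pi.sub_apply, norm_sub_rev]
    linarith [norm_sub_norm_le (x i) (xh i)]
  have hSc : ∑ i ∈ Sᶜ, ‖(xh - x) i‖ ≤ ∑ i ∈ Sᶜ, ‖xh i‖ + ∑ i ∈ Sᶜ, ‖x i‖ := by
    rw [← Finset.sum_add_distrib]
    exact Finset.sum_le_sum fun i _ => norm_sub_le _ _
  simp only [mnorm1] at hle ⊢
  rw [← Finset.sum_add_sum_compl S] at hle ⊢
  rw [← Finset.sum_add_sum_compl S (fun i => ‖x i‖)] at hle
  linarith

/-- Mixed ℓ₂/ℓ₁ error bound for the block Basis Pursuit with block compressible signals. -/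
theorem stmt_12 {p n m : ℕ}
    (A : (Fin p → EuclideanSpace ℝ (Fin n)) →ₗ[ℝ] EuclideanSpace ℝ (Fin m))
    (q : ℝ) (hq : 1 < q) (k : ℕ) (hk : 1 ≤ k)
    (x : Fin p → EuclideanSpace ℝ (Fin n))
    (S : Finset (Fin p)) (hScard : S.card = k)
    (hSlargest : ∀ i ∈ S, ∀ j ∉ S, ‖x j‖ ≤ ‖x i‖)
    (φ : ℝ) (hφ : φ = ∑ i ∈ Sᶜ, ‖x i‖)
    (ζ : ℝ) (hζ : 0 ≤ ζ)
    (ε : EuclideanSpace ℝ (Fin m)) (hε : ‖ε‖ ≤ ζ)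
    (y : EuclideanSpace ℝ (Fin m)) (hy : y = A x + ε)
    (xh : Fin p → EuclideanSpace ℝ (Fin n))
    (hfeas : ‖y - A xh‖ ≤ ζ)
    (hmin : ∀ z : Fin p → EuclideanSpace ℝ (Fin n), ‖y - A z‖ ≤ ζ → mnorm1 xh ≤ mnorm1 z)
    (β : ℝ) (hβ : 0 < β)
    (hcmsv : ∀ z : Fin p → EuclideanSpace ℝ (Fin n),
      mnorm1 z ≤ 4 * (k : ℝ) ^ (1 - 1 / q) * mnorm q z → β * mnorm q z ≤ ‖A z‖) :
    mnorm1 (xh - x) ≤ 4 * (k : ℝ) ^ (1 - 1 / q) * ζ / β + 4 * φ := by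
  have hxfeas : ‖y - A x‖ ≤ ζ := by simpa [hy] using hε
  have hcone := mnorm1_sub_le (hmin x hxfeas) S
  have hholder := sum_norm_le_card_rpow_mul_mnorm hq.le (xh - x) S
  rw [hScard] at hholder
  rw [← hφ] at hcone
  have hφ0 : 0 ≤ φ := hφ ▸ Finset.sum_nonneg fun i _ => norm_nonneg _
  have hAh : ‖A (xh - x)‖ ≤ 2 * ζ := by
    have hsplit : A (xh - x) = (y - A x) - (y - A xh) := by rw [map_sub]; abel
    rw [hsplit]
    linarith [norm_sub_le (y - A x) (y - A xh)]
  rcases le_or_gt (mnorm1 (xh - x)) (4 * (k : ℝ) ^ (1 - 1 / q) * mnorm q (xh - x)) with hc | hc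
  · have hM : mnorm q (xh - x) ≤ 2 * ζ / β := by
      rw [le_div_iff₀ hβ, mul_comm]
      exact (hcmsv _ hc).trans hAh
    have hK : (k : ℝ) ^ (1 - 1 / q) * mnorm q (xh - x) ≤ (k : ℝ) ^ (1 - 1 / q) * (2 * ζ / β) := by
      gcongr
    have hrw : 4 * (k : ℝ) ^ (1 - 1 / q) * ζ / β = 2 * ((k : ℝ) ^ (1 - 1 / q) * (2 * ζ / β)) := by
      ring
    linarith
  · have hnn : 0 ≤ 4 * (k : ℝ) ^ (1 - 1 / q) * ζ / β := by positivity
    linarith
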